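/- arXiv:1308.4203 — 2 statements merged into one kernel-verified Lean document; each statement's English description precedes it below -/
import Mathlib

section
/- The map (a,b) ↦ g_{a,b}Γ from Ω to the coset space SL(2,ℝ)/Γ is injective: if (a,b), (a',b') ∈ Ω and g_{a,b}⁻¹ g_{a',b'} ∈ Γ, then (a,b) = (a',b'). -/
open Matrix MeasureTheory Filter Topology

noncomputable section

abbrev SL2 := Matrix.SpecialLinearGroup (Fin 2) ℝ

/-- The golden ratio φ = (1+√5)/2. -/
def phi : ℝ := (1 + Real.sqrt 5) / 2

/-- φ̄ = 1/φ. -/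
def phib : ℝ := phi⁻¹

/-- S = [[0,−1],[1,0]]. -/
def Smat : SL2 := ⟨!![0, -1; 1, 0], by norm_num [Matrix.det_fin_two_of]⟩

/-- P = [[1,φ],[0,1]]. -/
def Pmat : SL2 := ⟨!![1, phi; 0, 1], by norm_num [Matrix.det_fin_two_of]⟩

/-- The Veech group of the golden L: the subgroup generated by S and P. -/
def Γ : Subgroup SL2 := Subgroup.closure {Smat, Pmat}

/-- Linear action of a 2×2 matrix on ℝ². -/
def mact (g : Matrix (Fin 2) (Fin 2) ℝ) (v : ℝ × ℝ) : ℝ × ℝ :=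
  (g 0 0 * v.1 + g 0 1 * v.2, g 1 0 * v.1 + g 1 1 * v.2)

/-- Λ = Γ·(1,0)ᵀ. -/
def Λ : Set (ℝ × ℝ) := {v | ∃ γ ∈ Γ, v = mact (γ : Matrix (Fin 2) (Fin 2) ℝ) (1, 0)}

/-- g_{a,b} = [[a,b],[0,1/a]]. -/
def gab (a b : ℝ) : Matrix (Fin 2) (Fin 2) ℝ := !![a, b; 0, a⁻¹]

/-- h_s = [[1,0],[−s,1]]. -/
def hmat (s : ℝ) : Matrix (Fin 2) (Fin 2) ℝ := !![1, 0; -s, 1]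

/-- Ω = {(a,b) : 0 < a ≤ 1, 1 − aφ < b ≤ 1}. -/
def Ω : Set (ℝ × ℝ) := {p | 0 < p.1 ∧ p.1 ≤ 1 ∧ 1 - p.1 * phi < p.2 ∧ p.2 ≤ 1}

/-- Ω₁ = {(a,b) ∈ Ω : φ̄ ≤ a ≤ 1, 1 − aφ < b ≤ φ̄ − a}. -/
def Ω₁ : Set (ℝ × ℝ) :=
  {p | p ∈ Ω ∧ phib ≤ p.1 ∧ p.1 ≤ 1 ∧ 1 - p.1 * phi < p.2 ∧ p.2 ≤ phib - p.1}

/-- Ω_φ = {(a,b) ∈ Ω : φ̄² ≤ a ≤ 1, φ̄ − a < b ≤ φ̄ − aφ̄}. -/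
def Ωphi : Set (ℝ × ℝ) :=
  {p | p ∈ Ω ∧ phib ^ 2 ≤ p.1 ∧ p.1 ≤ 1 ∧ phib - p.1 < p.2 ∧ p.2 ≤ phib - p.1 * phib}

/-- Ω_∞ = {(a,b) ∈ Ω : φ̄ − aφ̄ < b ≤ 1}. -/
def Ωinf : Set (ℝ × ℝ) := {p | p ∈ Ω ∧ phib - p.1 * phib < p.2 ∧ p.2 ≤ 1}

-- The return time function R.
open Classical in
noncomputable def Rfun (p : ℝ × ℝ) : ℝ :=
  if p ∈ Ω₁ then 1 / (p.1 * (p.1 + p.2))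
  else if p ∈ Ωphi then 1 / (p.1 * (p.1 * phib + p.2))
  else 1 / (p.1 * p.2)

/-- The probability measure m with dm = (2/φ) da db on Ω. -/
noncomputable def m : Measure (ℝ × ℝ) := ENNReal.ofReal (2 / phi) • volume.restrict Ω

-- The golden-L BCZ map T.
open Classical in
noncomputable def Tmap (p : ℝ × ℝ) : ℝ × ℝ :=
  if p ∈ Ω₁ then
    ((p.1 + p.2) * phi,
      p.1 + p.2 * phi +
        (-(⌊(p.1 + p.2 * phi - 1) / (phi ^ 2 * (p.1 + p.2))⌋ : ℤ) : ℝ) * phi ^ 2 * (p.1 + p.2))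
  else if p ∈ Ωphi then
    (p.1 + p.2 * phi,
      p.2 + (-(⌊(p.2 - 1) / (phi * (p.1 + p.2 * phi))⌋ : ℤ) : ℝ) * phi * (p.1 + p.2 * phi))
  else
    (p.2, -p.1 + (-(⌊(-p.1 - 1) / (phi * p.2)⌋ : ℤ) : ℝ) * phi * p.2)

theorem phi_sq : phi * phi = phi + 1 := by
  have h : Real.sqrt 5 * Real.sqrt 5 = 5 := Real.mul_self_sqrt (by norm_num)
  unfold phi
  linarith

theorem phi_pos : 0 < phi := by
  unfold phi
  positivity

/-- The monoid generated by the four matrices whose columns span the consecutive sectors cut out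
of the first quadrant by `(1,0), (φ,1), (φ,φ), (1,φ), (0,1)`. -/
inductive SectorMonoid : Matrix (Fin 2) (Fin 2) ℝ → Prop
  | one : SectorMonoid 1
  | mul₀ {w} : SectorMonoid w → SectorMonoid (!![1, phi; 0, 1] * w)
  | mul₁ {w} : SectorMonoid w → SectorMonoid (!![phi, phi; 1, phi] * w)
  | mul₂ {w} : SectorMonoid w → SectorMonoid (!![phi, 1; phi, phi] * w)
  | mul₃ {w} : SectorMonoid w → SectorMonoid (!![1, 0; phi, 1] * w)

namespace SectorMonoid

variable {w : Matrix (Fin 2) (Fin 2) ℝ}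

theorem entries (h : SectorMonoid w) :
    0 < w 0 0 ∧ 0 ≤ w 0 1 ∧ 0 ≤ w 1 0 ∧ 0 < w 1 1 := by
  have hφ := phi_pos
  induction h with
  | one => simp
  | _ _ ih =>
    obtain ⟨h₁, h₂, h₃, h₄⟩ := ih
    simp only [Matrix.mul_apply, Fin.sum_univ_two, Matrix.of_apply, Matrix.cons_val',
      Matrix.cons_val_zero, Matrix.cons_val_one, Matrix.cons_val_fin_one]
    refine ⟨?_, ?_, ?_, ?_⟩ <;> positivity

theorem of_lower_left_eq_zero (h : SectorMonoid w) (h0 : w 1 0 = 0) :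
    w 0 0 = 1 ∧ w 1 1 = 1 ∧ ∃ n : ℤ, w 0 1 = n * phi := by
  have hφ := phi_pos
  induction h with
  | one => exact ⟨by simp, by simp, 0, by simp⟩
  | mul₀ hw ih =>
    simp only [Matrix.mul_apply, Fin.sum_univ_two, Matrix.of_apply, Matrix.cons_val',
      Matrix.cons_val_zero, Matrix.cons_val_one, Matrix.cons_val_fin_one, zero_mul, one_mul, zero_add] at h0 ⊢
    obtain ⟨h₁, h₂, n, h₃⟩ := ih h0
    refine ⟨by simp [h₁, h0], h₂, n + 1, ?_⟩
    rw [h₂, h₃]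
    push_cast
    ring
  | _ hw ih =>
    obtain ⟨h₁, h₂, h₃, h₄⟩ := hw.entries
    simp only [Matrix.mul_apply, Fin.sum_univ_two, Matrix.of_apply, Matrix.cons_val',
      Matrix.cons_val_zero, Matrix.cons_val_one, Matrix.cons_val_fin_one] at h0
    exact absurd h0 (by positivity)

theorem of_upper_right_eq_zero (h : SectorMonoid w) (h0 : w 0 1 = 0) :
    w 0 0 = 1 ∧ w 1 1 = 1 ∧ ∃ n : ℤ, w 1 0 = n * phi := by
  have hφ := phi_pos
  induction h with
  | one => exact ⟨by simp, by simp, 0, by simp⟩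
  | mul₃ hw ih =>
    simp only [Matrix.mul_apply, Fin.sum_univ_two, Matrix.of_apply, Matrix.cons_val',
      Matrix.cons_val_zero, Matrix.cons_val_one, Matrix.cons_val_fin_one, zero_mul, one_mul, add_zero] at h0 ⊢
    obtain ⟨h₁, h₂, n, h₃⟩ := ih h0
    refine ⟨h₁, by simp [h₂, h0], n + 1, ?_⟩
    rw [h₁, h₃]
    push_cast
    ring
  | _ hw ih =>
    obtain ⟨h₁, h₂, h₃, h₄⟩ := hw.entries
    simp only [Matrix.mul_apply, Fin.sum_univ_two, Matrix.of_apply, Matrix.cons_val',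
      Matrix.cons_val_zero, Matrix.cons_val_one, Matrix.cons_val_fin_one] at h0
    exact absurd h0 (by positivity)

end SectorMonoid

/-- Matrices of the form `± Sⁱ w Sʲ` with `w` in the sector monoid and `i, j ∈ {0, 1}`. -/
def SectorForm (g : Matrix (Fin 2) (Fin 2) ℝ) : Prop :=
  ∃ w, SectorMonoid w ∧ ∃ ε : ℝ, ε * ε = 1 ∧ ∃ x y : Matrix (Fin 2) (Fin 2) ℝ,
    (x = 1 ∨ x = !![0, -1; 1, 0]) ∧ (y = 1 ∨ y = !![0, -1; 1, 0]) ∧ g = ε • (x * w * y)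

namespace SectorForm

variable {g : Matrix (Fin 2) (Fin 2) ℝ}

theorem neg (h : SectorForm g) : SectorForm (-g) := by
  obtain ⟨w, hw, ε, hε, x, y, hx, hy, rfl⟩ := h
  exact ⟨w, hw, -ε, by linarith, x, y, hx, hy, by rw [neg_smul]⟩

theorem S_mul (h : SectorForm g) : SectorForm (!![0, -1; 1, 0] * g) := by
  obtain ⟨w, hw, ε, hε, x, y, rfl | rfl, hy, rfl⟩ := h
  · exact ⟨w, hw, ε, hε, _, y, Or.inr rfl, hy, by simp⟩
  · refine ⟨w, hw, -ε, by linarith, 1, y, Or.inl rfl, hy, ?_⟩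
    have : (!![0, -1; 1, 0] * !![0, -1; 1, 0] : Matrix (Fin 2) (Fin 2) ℝ) = -1 := by
      ext i j; fin_cases i <;> fin_cases j <;> simp
    rw [Matrix.mul_smul, ← Matrix.mul_assoc, ← Matrix.mul_assoc, this]
    simp

theorem P_mul (h : SectorForm g) : SectorForm (!![1, phi; 0, 1] * g) := by
  have hφ := phi_sq
  obtain ⟨w, hw, ε, hε, x, y, rfl | rfl, hy, rfl⟩ := h
  · exact ⟨_, hw.mul₀, ε, hε, 1, y, Or.inl rfl, hy, by simp⟩
  · have key : ∀ v, !![1, phi; 0, 1] * (ε • (!![0, -1; 1, 0] * v * y)) =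
        ε • ((!![1, phi; 0, 1] * !![0, -1; 1, 0]) * v * y) := by
      intro v
      simp only [Matrix.mul_smul, Matrix.mul_assoc]
    have shift : ∀ {A B : Matrix (Fin 2) (Fin 2) ℝ} {v},
        !![1, phi; 0, 1] * !![0, -1; 1, 0] * A = B → SectorMonoid (B * v) →
        SectorForm (ε • ((!![1, phi; 0, 1] * !![0, -1; 1, 0]) * (A * v) * y)) := by
      intro A B v hAB hB
      exact ⟨_, hB, ε, hε, 1, y, Or.inl rfl, hy, by
        rw [← hAB]; simp only [Matrix.mul_assoc, Matrix.one_mul]⟩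
    rw [key]
    cases hw with
    | one =>
      obtain rfl | rfl := hy
      · refine ⟨_, SectorMonoid.one.mul₀, ε, hε, 1, _, Or.inl rfl, Or.inr rfl, ?_⟩
        simp only [Matrix.mul_one, Matrix.one_mul]
      · refine ⟨_, SectorMonoid.one.mul₀, -ε, by linarith, 1, 1, Or.inl rfl, Or.inl rfl, ?_⟩
        ext i j; fin_cases i <;> fin_cases j <;> simp
    | mul₀ hv =>
      refine shift ?_ hv.mul₁
      ext i j; fin_cases i <;> fin_cases j <;> simp
      all_goals linarith
    | mul₁ hv =>
      refine shift ?_ hv.mul₂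
      ext i j; fin_cases i <;> fin_cases j <;> simp
      all_goals linarith
    | mul₂ hv =>
      refine shift ?_ hv.mul₃
      ext i j; fin_cases i <;> fin_cases j <;> simp
      all_goals linarith
    | @mul₃ v hv =>
      refine ⟨v, hv, ε, hε, _, y, Or.inr rfl, hy, ?_⟩
      rw [← Matrix.mul_assoc _ _ v]
      congr 3
      ext i j; fin_cases i <;> fin_cases j <;> simp

end SectorForm

theorem sectorForm_of_mem_Γ {γ : SL2} (h : γ ∈ Γ) :
    SectorForm (γ : Matrix (Fin 2) (Fin 2) ℝ) := by
  have hφ := phi_sq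
  refine Subgroup.closure_induction_left (s := {Smat, Pmat})
    (p := fun (γ : SL2) _ ↦ SectorForm (γ : Matrix (Fin 2) (Fin 2) ℝ))
    ?_ ?_ ?_ h
  · exact ⟨1, .one, 1, by norm_num, 1, 1, Or.inl rfl, Or.inl rfl, by simp⟩
  · rintro x (rfl | rfl) y - ih
    · exact ih.S_mul
    · exact ih.P_mul
  · rintro x (rfl | rfl) y - ih
    · convert ih.S_mul.neg using 1
      rw [Matrix.SpecialLinearGroup.coe_mul, ← Matrix.neg_mul]
      congr 1
      ext i j; fin_cases i <;> fin_cases j <;>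
        simp [Matrix.SpecialLinearGroup.coe_inv, Matrix.adjugate_fin_two] <;> simp [Smat]
    · convert ih.S_mul.P_mul.S_mul.P_mul.S_mul.P_mul.S_mul.P_mul.S_mul.neg using 1
      rw [Matrix.SpecialLinearGroup.coe_mul]
      simp only [← Matrix.mul_assoc, ← Matrix.neg_mul]
      congr 1
      ext i j; fin_cases i <;> fin_cases j <;>
        simp [Matrix.SpecialLinearGroup.coe_inv, Matrix.adjugate_fin_two] <;> simp [Pmat] <;> grind

/-- Elements of `Γ` fixing the horizontal direction are `± Pⁿ`. -/
theorem Γ_upper_triangular {γ : SL2} (h : γ ∈ Γ) (h0 : γ 1 0 = 0) :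
    γ 0 0 * γ 0 0 = 1 ∧ ∃ n : ℤ, γ 0 1 = n * phi := by
  obtain ⟨w, hw, ε, hε, x, y, hx, hy, hγ⟩ := sectorForm_of_mem_Γ h
  have hε0 : ε ≠ 0 := by rintro rfl; simp at hε
  obtain ⟨h₁, -, -, h₄⟩ := hw.entries
  have hsign : ∃ k : ℤ, ε = k := by
    rcases mul_self_eq_one_iff.1 hε with rfl | rfl
    · exact ⟨1, by simp⟩
    · exact ⟨-1, by simp⟩
  obtain ⟨k, hk⟩ := hsign
  rw [hγ] at h0 ⊢
  obtain rfl | rfl := hx <;> obtain rfl | rfl := hy <;>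
    simp [Matrix.mul_apply, Matrix.vecMul, dotProduct, Fin.sum_univ_two, hε0, h₁.ne', h₄.ne']
      at h0 ⊢
  · obtain ⟨h₁, h₂, n, h₃⟩ := hw.of_lower_left_eq_zero h0
    rw [h₁, h₃]
    exact ⟨by linarith, k * n, by rw [hk]; push_cast; ring⟩
  · obtain ⟨h₁, h₂, n, h₃⟩ := hw.of_upper_right_eq_zero h0
    rw [h₂, h₃]
    exact ⟨by linarith, k * n, by rw [hk]; push_cast; ring⟩

/-- The map (a,b) ↦ g_{a,b}Γ from Ω to SL(2,ℝ)/Γ is injective: if g_{a,b}⁻¹ g_{a',b'} ∈ Γ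
(i.e. g_{a',b'} = g_{a,b}·γ for some γ ∈ Γ), then (a,b) = (a',b'). -/
theorem section_injective :
    ∀ a b a' b' : ℝ, (a, b) ∈ Ω → (a', b') ∈ Ω →
      (∃ γ ∈ Γ, gab a b * (γ : Matrix (Fin 2) (Fin 2) ℝ) = gab a' b') →
      a = a' ∧ b = b' := by
  rintro a b a' b' ⟨ha, -, hb, hb1⟩ ⟨ha', -, hb', hb1'⟩ ⟨γ, hγ, h⟩
  have hφ := phi_pos
  have e00 := congrFun (congrFun h 0) 0
  have e01 := congrFun (congrFun h 0) 1
  have e10 := congrFun (congrFun h 1) 0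
  have e11 := congrFun (congrFun h 1) 1
  simp only at ha ha' hb hb1 hb' hb1'
  simp [gab, Matrix.mul_apply, Fin.sum_univ_two, ha.ne'] at e00 e01 e10 e11
  obtain ⟨h00, n, h01⟩ := Γ_upper_triangular hγ e10
  rw [e10, mul_zero, add_zero] at e00
  have haa : a = a' := by
    rcases mul_self_eq_one_iff.1 h00 with h1 | h1 <;> rw [h1] at e00 <;> linarith
  subst haa
  have h11 : γ 1 1 = 1 := by
    field_simp at e11
    exact e11
  rw [h01, h11] at e01
  have haφ : 0 < a * phi := by positivity
  have hn : n = 0 := by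
    have h1 : (n : ℝ) < 1 := by
      by_contra! hc
      nlinarith
    have h2 : (-1 : ℝ) < n := by
      by_contra! hc
      nlinarith
    have h1' : n < 1 := by exact_mod_cast h1
    have h2' : -1 < n := by exact_mod_cast h2
    omega
  subst hn
  refine ⟨rfl, ?_⟩
  simpa using e01
end
end

section
/- For every g ∈ SL(2,ℝ) such that the set g·Λ contains a point of the horizontal segment (0,1]×{0}, there exists (a,b) ∈ Ω with g⁻¹ g_{a,b} ∈ Γ (i.e., gΓ = g_{a,b}Γ in SL(2,ℝ)/Γ). Conversely, for every (a,b) ∈ Ω the set g_{a,b}·Λ contains the point (a,0) ∈ (0,1]×{0}. Thus (a,b) ↦ g_{a,b}Γ maps Ω onto the set Ω_X = {gΓ ∈ SL(2,ℝ)/Γ : gΛ ∩ ((0,1]×{0}) ≠ ∅}. -/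
open Matrix MeasureTheory Filter Topology

noncomputable section

theorem coe_SL2_mul (g h : SL2) :
    ((g * h : SL2) : Matrix (Fin 2) (Fin 2) ℝ) =
      (g : Matrix (Fin 2) (Fin 2) ℝ) * (h : Matrix (Fin 2) (Fin 2) ℝ) :=
  Matrix.SpecialLinearGroup.coe_mul g h

theorem coe_Pmat_inv : ((Pmat⁻¹ : SL2) : Matrix (Fin 2) (Fin 2) ℝ) = !![1, -phi; 0, 1] := by
  have h : ((Pmat⁻¹ : SL2) : Matrix (Fin 2) (Fin 2) ℝ) = adjugate !![1, phi; 0, 1] :=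
    Matrix.SpecialLinearGroup.coe_inv Pmat
  rw [h, adjugate_fin_two_of, neg_zero]

/-- The integer powers of `Pmat` are the horizontal shears by integer multiples of `phi`. -/
theorem coe_Pmat_zpow (n : ℤ) :
    ((Pmat ^ n : SL2) : Matrix (Fin 2) (Fin 2) ℝ) = !![1, n * phi; 0, 1] := by
  induction n with
  | zero => simp [Matrix.one_fin_two]
  | succ n ih =>
    rw [_root_.zpow_add_one, coe_SL2_mul, ih]
    ext i j
    fin_cases i <;> fin_cases j <;> simp [Pmat]
    ring
  | pred n ih =>
    rw [_root_.zpow_sub_one, coe_SL2_mul, ih, coe_Pmat_inv]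
    ext i j
    fin_cases i <;> fin_cases j <;> simp
    ring

theorem Pmat_zpow_mem (n : ℤ) : Pmat ^ n ∈ Γ :=
  Γ.zpow_mem (Subgroup.subset_closure (by simp)) n

theorem mact_mul (g h : Matrix (Fin 2) (Fin 2) ℝ) (v : ℝ × ℝ) :
    mact (g * h) v = mact g (mact h v) := by
  ext <;> simp [mact, Matrix.mul_apply, Fin.sum_univ_two] <;> ring

/-- A matrix of determinant one with vanishing lower left entry is some `gab a b`. -/
theorem coe_eq_gab (g : SL2) (h : g 1 0 = 0) :
    (g : Matrix (Fin 2) (Fin 2) ℝ) = gab (g 0 0) (g 0 1) := by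
  have hdet : g 0 0 * g 1 1 = 1 := by
    have := g.det_coe
    rw [Matrix.det_fin_two, h] at this
    simpa using this
  have hinv : g 1 1 = (g 0 0)⁻¹ := eq_inv_of_mul_eq_one_right hdet
  ext i j
  fin_cases i <;> fin_cases j <;> simp [gab, h, hinv]

theorem gab_mul_shear (a b t : ℝ) : gab a b * !![1, t; 0, 1] = gab a (b + a * t) := by
  simp [gab, add_comm]

/-- (a,b) ↦ g_{a,b}Γ maps Ω onto Ω_X = {gΓ : gΛ ∩ ((0,1]×{0}) ≠ ∅}: every g ∈ SL(2,ℝ)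
whose orbit set gΛ meets the segment (0,1]×{0} satisfies gΓ = g_{a,b}Γ for some
(a,b) ∈ Ω (i.e. g_{a,b} = g·γ for some γ ∈ Γ); conversely every g_{a,b}Λ with
(a,b) ∈ Ω contains the point (a,0) of that segment. -/
theorem section_surjective :
    (∀ g : SL2,
      (∃ v ∈ Λ, 0 < (mact (g : Matrix (Fin 2) (Fin 2) ℝ) v).1 ∧
        (mact (g : Matrix (Fin 2) (Fin 2) ℝ) v).1 ≤ 1 ∧
        (mact (g : Matrix (Fin 2) (Fin 2) ℝ) v).2 = 0) →
      ∃ a b : ℝ, (a, b) ∈ Ω ∧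
        ∃ γ ∈ Γ,
          (g : Matrix (Fin 2) (Fin 2) ℝ) * (γ : Matrix (Fin 2) (Fin 2) ℝ) = gab a b) ∧
    (∀ a b : ℝ, (a, b) ∈ Ω →
      (∃ v ∈ Λ, mact (gab a b) v = (a, 0)) ∧ 0 < a ∧ a ≤ 1) := by
  refine ⟨?_, fun a b hab => ⟨⟨(1, 0), ⟨1, Γ.one_mem, ?_⟩, ?_⟩, hab.1, hab.2.1⟩⟩
  · rintro g ⟨_, ⟨γ, hγ, rfl⟩, hpos, hle, hzero⟩
    rw [← mact_mul, ← coe_SL2_mul] at hpos hle hzero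
    simp only [mact, mul_one, mul_zero, add_zero] at hpos hle hzero
    have hp := mul_pos hpos phi_pos
    obtain ⟨n, ⟨hn₁, hn₂⟩, -⟩ :=
      existsUnique_add_zsmul_mem_Ioc hp ((g * γ) 0 1) (1 - (g * γ) 0 0 * phi)
    rw [zsmul_eq_mul] at hn₁ hn₂
    refine ⟨(g * γ) 0 0, (g * γ) 0 1 + (g * γ) 0 0 * (n * phi),
      ⟨hpos, hle, ?_, ?_⟩, γ * Pmat ^ n, Γ.mul_mem hγ (Pmat_zpow_mem n), ?_⟩
    · dsimp only
      linarith
    · dsimp only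
      linarith
    · rw [coe_SL2_mul, ← mul_assoc, ← coe_SL2_mul,
        coe_Pmat_zpow, ← gab_mul_shear]
      exact congrArg (· * _) (coe_eq_gab (g * γ) hzero)
  · simp [mact]
  · simp [mact, gab]
end
end
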